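/- arXiv:math/0108077 — 2 statements merged into one kernel-verified Lean document; each statement's English description precedes it below -/
import Mathlib

section
/- Let β > 0. There exists b* = b*(β) > 0 such that for every δ > 0 and every 0 < b < b*, E_0[e^{−βJ_n} · 1{J_n ≤ n^{1−δ}}] = o(E_0[e^{−βJ_n} · 1{J_n < bn}]) as n → ∞. -/
open Filter Real Finset

noncomputable section

/-- The four unit steps of the planar nearest-neighbour walk. -/
def dir : Fin 4 → ℤ × ℤ
  | 0 => (1, 0)
  | 1 => (-1, 0)
  | 2 => (0, 1)
  | 3 => (0, -1)

/-- Position after `k` steps of the walk encoded by the step sequence `ω`. -/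
def pos (n : ℕ) (ω : Fin n → Fin 4) (k : ℕ) : ℤ × ℤ :=
  ∑ i : Fin n, if (i : ℕ) < k then dir (ω i) else 0

/-- Number of self-intersections `J_n = Σ_{0 ≤ i < j ≤ n} 1{S_i = S_j}`. -/
def J (n : ℕ) (ω : Fin n → Fin 4) : ℕ :=
  ((Finset.range (n + 1) ×ˢ Finset.range (n + 1)).filter
    (fun p => p.1 < p.2 ∧ pos n ω p.1 = pos n ω p.2)).card

/-- Euclidean distance `χ_n = |S_n|` of the endpoint from the origin. -/
def chi (n : ℕ) (ω : Fin n → Fin 4) : ℝ :=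
  Real.sqrt (((pos n ω n).1 : ℝ) ^ 2 + ((pos n ω n).2 : ℝ) ^ 2)

/-- Expectation under the uniform measure `P_0` on the `4^n` paths of length `n`. -/
def E0 (n : ℕ) (f : (Fin n → Fin 4) → ℝ) : ℝ :=
  (∑ ω : Fin n → Fin 4, f ω) / 4 ^ n

/-- Expectation `E_β` under the weakly self-avoiding walk measure `Q_n^β`. -/
def Ewsaw (β : ℝ) (n : ℕ) (f : (Fin n → Fin 4) → ℝ) : ℝ :=
  E0 n (fun ω => f ω * Real.exp (-β * J n ω)) /
    E0 n (fun ω => Real.exp (-β * J n ω))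

/-- The set `Γ_n` of self-avoiding paths of length `n`. -/
def SAW (n : ℕ) : Finset (Fin n → Fin 4) :=
  Finset.univ.filter (fun ω => J n ω = 0)

/-- Expectation with respect to the uniform distribution on `Γ_n`. -/
def Esaw (n : ℕ) (f : (Fin n → Fin 4) → ℝ) : ℝ :=
  (∑ ω ∈ SAW n, f ω) / (SAW n).card

/-- The index of the step opposite to a given one. -/
def opp : Fin 4 → Fin 4 := ![1, 0, 3, 2]

lemma dir_opp (s : Fin 4) : dir (opp s) = -dir s := by
  fin_cases s <;> simp [opp, dir]

/-- The list of vertices visited by a walk started at `x` with a given list of steps. -/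
def visits (x : ℤ × ℤ) : List (Fin 4) → List (ℤ × ℤ)
  | [] => [x]
  | s :: w => x :: visits (x + dir s) w

/-- The number of pairs of equal entries of a list. -/
def selfInt {α : Type*} [DecidableEq α] : List α → ℕ
  | [] => 0
  | x :: l => l.count x + selfInt l

lemma selfInt_append_singleton {α : Type*} [DecidableEq α] (l : List α) (x : α) :
    selfInt (l ++ [x]) = selfInt l + l.count x := by
  induction l with
  | nil => simp [selfInt]
  | cons y l ih =>
    simp only [List.cons_append, selfInt, ih, List.count_append, List.count_cons, List.count_nil]
    by_cases h : x = y
    · subst h; simp; omega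
    · simp [h, Ne.symm h]; omega

lemma selfInt_map_range {α : Type*} [DecidableEq α] (p : ℕ → α) (n : ℕ) :
    selfInt ((List.range n).map p) =
      ((Finset.range n ×ˢ Finset.range n).filter (fun q => q.1 < q.2 ∧ p q.1 = p q.2)).card := by
  induction n with
  | zero => simp [selfInt]
  | succ n ih =>
    have hcount : ((List.range n).map p).count (p n) =
        ∑ i ∈ Finset.range n, if p i = p n then 1 else 0 := by
      clear ih
      generalize p n = y
      induction n with
      | zero => simp
      | succ n ih =>
        rw [List.range_succ, List.map_append, List.count_append, ih, Finset.sum_range_succ]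
        simp [List.count_singleton]
    rw [List.range_succ, List.map_append, List.map_singleton, selfInt_append_singleton, ih, hcount,
      Finset.card_filter, Finset.card_filter, Finset.sum_product, Finset.sum_product,
      Finset.sum_range_succ]
    simp only [Finset.sum_range_succ, Finset.sum_add_distrib]
    have h1 : ∀ i ∈ Finset.range n, (if i < n ∧ p i = p n then 1 else 0) =
        if p i = p n then 1 else 0 := by
      intro i hi
      simp [Finset.mem_range.1 hi]
    have h2 : ∀ i ∈ Finset.range n, (if n < i ∧ p n = p i then 1 else 0) = 0 := by
      intro i hi
      simp [(Finset.mem_range.1 hi).le]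
    rw [Finset.sum_congr rfl h1, Finset.sum_congr rfl h2]
    simp

lemma sum_sq_count {α : Type*} [DecidableEq α] (l : List α) (T : Finset α)
    (hT : l.toFinset ⊆ T) :
    ∑ x ∈ T, l.count x ^ 2 = 2 * selfInt l + l.length := by
  induction l with
  | nil => simp [selfInt]
  | cons y l ih =>
    rw [List.toFinset_cons, Finset.insert_subset_iff] at hT
    have h : ∀ x ∈ T, (y :: l).count x ^ 2 =
        l.count x ^ 2 + if y = x then 2 * l.count x + 1 else 0 := by
      intro x _
      by_cases hx : y = x
      · subst hx; simp; ring
      · simp [hx]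
    rw [Finset.sum_congr rfl h, Finset.sum_add_distrib, ih hT.2, Finset.sum_ite_eq, if_pos hT.1]
    simp only [selfInt, List.length_cons]
    ring

/-- If `l'` repeats the entries of `l`, each at most three times as often, then its number of
coincidences is controlled by the one of `l` and by the number of added entries. -/
lemma selfInt_le_of_count_le {α : Type*} [DecidableEq α] (l l' : List α) (k : ℕ)
    (h1 : ∀ x, l.count x ≤ l'.count x) (h2 : ∀ x, l'.count x ≤ 3 * l.count x)
    (hlen : l'.length = l.length + 2 * k) :
    selfInt l' ≤ 9 * selfInt l + 3 * k := by
  have hsub : l.toFinset ⊆ l'.toFinset := by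
    intro x hx
    rw [List.mem_toFinset, ← List.count_pos_iff] at *
    exact hx.trans_le (h1 x)
  have e1 := sum_sq_count l _ hsub
  have e2 := sum_sq_count l' _ subset_rfl
  have e3 : ∑ x ∈ l'.toFinset, l.count x = l.length := by
    rw [← List.sum_toFinset_count_eq_length l]
    refine (Finset.sum_subset hsub fun x _ hx => ?_).symm
    rwa [List.mem_toFinset, ← List.count_eq_zero] at hx
  have e4 : ∑ x ∈ l'.toFinset, l'.count x = l'.length := List.sum_toFinset_count_eq_length l'
  have key : ∑ x ∈ l'.toFinset, (l'.count x ^ 2 + 12 * l.count x) ≤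
      ∑ x ∈ l'.toFinset, (9 * l.count x ^ 2 + 4 * l'.count x) := by
    refine Finset.sum_le_sum fun x _ => ?_
    obtain ⟨a, ha⟩ := Nat.exists_eq_add_of_le (h1 x)
    have h3 := h2 x
    rw [ha] at h3 ⊢
    rcases Nat.eq_zero_or_pos (l.count x) with h | h
    · rw [h] at h3 ⊢
      have : a = 0 := by omega
      subst this; simp
    · obtain ⟨c, hc⟩ := Nat.exists_eq_add_of_le h
      rw [hc] at h3 ⊢
      nlinarith [Nat.mul_le_mul_left a (show a ≤ 2 * (1 + c) by omega),
        Nat.mul_le_mul_left c (show a ≤ 2 * (1 + c) by omega)]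
  simp only [Finset.sum_add_distrib, ← Finset.mul_sum, e1, e2, e3, e4] at key
  omega

lemma pos_cons_succ (n : ℕ) (s : Fin 4) (ω : Fin n → Fin 4) (k : ℕ) :
    pos (n + 1) (Fin.cons s ω) (k + 1) = dir s + pos n ω k := by
  simp [pos, Fin.sum_univ_succ]

lemma visits_ofFn (n : ℕ) (ω : Fin n → Fin 4) (x : ℤ × ℤ) :
    visits x (List.ofFn ω) = (List.range (n + 1)).map (fun k => x + pos n ω k) := by
  induction n generalizing x with
  | zero => simp [visits, pos]
  | succ n ih =>
    obtain ⟨s, w, rfl⟩ : ∃ s w, ω = Fin.cons s w := ⟨ω 0, Fin.tail ω, (Fin.cons_self_tail ω).symm⟩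
    rw [List.ofFn_cons, visits, ih, List.range_succ_eq_map (n := n + 1), List.map_cons,
      List.map_map]
    congr 1
    · simp [pos]
    · refine List.map_congr_left fun k _ => ?_
      simp [pos_cons_succ, add_assoc]

lemma selfInt_visits_ofFn (n : ℕ) (ω : Fin n → Fin 4) :
    selfInt (visits 0 (List.ofFn ω)) = J n ω := by
  rw [visits_ofFn, selfInt_map_range]
  simp [J]

lemma mem_visits_self (x : ℤ × ℤ) (w : List (Fin 4)) : x ∈ visits x w := by
  cases w <;> simp [visits]

lemma length_visits (x : ℤ × ℤ) (w : List (Fin 4)) : (visits x w).length = w.length + 1 := by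
  induction w generalizing x with
  | nil => rfl
  | cons s w ih => simp [visits, ih]

lemma visits_add (x a : ℤ × ℤ) (w : List (Fin 4)) :
    visits (x + a) w = (visits x w).map (· + a) := by
  induction w generalizing x with
  | nil => simp [visits]
  | cons s w ih => simp [visits, ← ih, add_right_comm]

lemma selfInt_map {α γ : Type*} [DecidableEq α] [DecidableEq γ] {f : α → γ}
    (hf : Function.Injective f) (l : List α) : selfInt (l.map f) = selfInt l := by
  induction l with
  | nil => rfl
  | cons x l ih => simp [selfInt, ih, List.count_map_of_injective _ _ hf]

/-- The number of self-intersections of a walk given by its list of steps. -/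
def loops (w : List (Fin 4)) : ℕ := selfInt (visits 0 w)

lemma selfInt_visits (x : ℤ × ℤ) (w : List (Fin 4)) : selfInt (visits x w) = loops w := by
  rw [loops, ← selfInt_map (add_left_injective x) (visits 0 w), ← visits_add, zero_add]

lemma count_instBEqOfDecidableEq (l : List (ℤ × ℤ)) (y : ℤ × ℤ) :
    @List.count _ instBEqOfDecidableEq y l = l.count y := by
  rw [lawful_beq_subsingleton (instBEqOfDecidableEq : BEq (ℤ × ℤ)) instBEqProd]

lemma loops_cons (s : Fin 4) (w : List (Fin 4)) :
    loops (s :: w) = (visits (dir s) w).count 0 + loops w := by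
  rw [loops, visits, selfInt, selfInt_visits, zero_add, count_instBEqOfDecidableEq]

lemma loops_le_cons (s : Fin 4) (w : List (Fin 4)) : loops w ≤ loops (s :: w) := by
  rw [loops_cons]; omega

lemma loops_backtrack (s : Fin 4) (w : List (Fin 4)) :
    loops (opp s :: w) + 1 ≤ loops (s :: opp s :: w) := by
  have h : 0 < (visits (dir s) (opp s :: w)).count 0 := by
    rw [List.count_pos_iff, visits, dir_opp, add_neg_cancel]
    exact List.mem_cons_of_mem _ (mem_visits_self _ _)
  rw [loops_cons s]; omega

/-- All ways of replacing `k` of the steps `s` of a walk by `s, -s, s`. -/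
def insertions : ℕ → List (Fin 4) → List (List (Fin 4))
  | 0, w => [w]
  | _ + 1, [] => []
  | k + 1, s :: w =>
    (insertions (k + 1) w).map (s :: ·) ++ (insertions k w).map (fun u => s :: opp s :: s :: u)

lemma length_insertions (k : ℕ) (w : List (Fin 4)) :
    (insertions k w).length = w.length.choose k := by
  induction w generalizing k with
  | nil => cases k <;> simp [insertions]
  | cons s w ih =>
    cases k with
    | zero => simp [insertions]
    | succ k => simp [insertions, ih, Nat.choose_succ_succ', add_comm (w.length.choose k)]

lemma count_visits_insertions (k : ℕ) (w u : List (Fin 4)) (hu : u ∈ insertions k w)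
    (x y : ℤ × ℤ) :
    (visits x w).count y ≤ (visits x u).count y ∧
      (visits x u).count y + (if x = y then 1 else 0) ≤ 3 * (visits x w).count y := by
  induction w generalizing k u x with
  | nil =>
    cases k with
    | zero =>
      obtain rfl : u = [] := by simpa [insertions] using hu
      simp [visits, List.count_singleton]
      split <;> simp
    | succ k => simp [insertions] at hu
  | cons s w ih =>
    cases k with
    | zero =>
      obtain rfl : u = s :: w := by simpa [insertions] using hu
      simp only [visits, List.count_cons, beq_iff_eq, le_refl, true_and]
      split <;> omega
    | succ k =>
      simp only [insertions, List.mem_append, List.mem_map] at hu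
      rcases hu with ⟨v, hv, rfl⟩ | ⟨v, hv, rfl⟩
      · have := ih _ _ hv (x + dir s)
        simp only [visits, List.count_cons, beq_iff_eq]
        split_ifs at * <;> omega
      · have := ih _ _ hv (x + dir s)
        simp only [visits, List.count_cons, beq_iff_eq, dir_opp, add_neg_cancel_right]
        split_ifs at * <;> omega

lemma length_of_mem_insertions (k : ℕ) (w u : List (Fin 4)) (hu : u ∈ insertions k w) :
    u.length = w.length + 2 * k := by
  induction w generalizing k u with
  | nil =>
    cases k with
    | zero => simpa [insertions] using hu
    | succ k => simp [insertions] at hu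
  | cons s w ih =>
    cases k with
    | zero => simp [insertions] at hu; simp [hu]
    | succ k =>
      simp only [insertions, List.mem_append, List.mem_map] at hu
      rcases hu with ⟨v, hv, rfl⟩ | ⟨v, hv, rfl⟩ <;>
      · have := ih _ _ hv
        simp only [List.length_cons]
        omega

lemma loops_insertions_le (k : ℕ) (w u : List (Fin 4)) (hu : u ∈ insertions k w) :
    loops u ≤ 9 * loops w + 3 * k := by
  refine selfInt_le_of_count_le _ _ k (fun y => ?_) (fun y => ?_) ?_
  · simpa only [count_instBEqOfDecidableEq] using (count_visits_insertions k w u hu 0 y).1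
  · simpa only [count_instBEqOfDecidableEq] using
      (Nat.le_add_right _ _).trans (count_visits_insertions k w u hu 0 y).2
  rw [length_visits, length_visits, length_of_mem_insertions k w u hu]
  omega

/-- The sum of `g` over all lists of `n` steps. -/
def walkSum (n : ℕ) (g : List (Fin 4) → ℕ) : ℕ := ∑ ω : Fin n → Fin 4, g (List.ofFn ω)

lemma walkSum_zero (g : List (Fin 4) → ℕ) : walkSum 0 g = g [] := by
  simp [walkSum]

lemma walkSum_succ (n : ℕ) (g : List (Fin 4) → ℕ) :
    walkSum (n + 1) g = ∑ s, walkSum n (fun w => g (s :: w)) := by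
  simp only [walkSum]
  rw [← Fintype.sum_prod_type', ← (Fin.consEquiv (fun _ : Fin (n + 1) => Fin 4)).sum_comp]
  refine Finset.sum_congr rfl fun p _ => ?_
  simp [Fin.consEquiv]

lemma walkSum_mono (n : ℕ) {f g : List (Fin 4) → ℕ} (h : ∀ w, w.length = n → f w ≤ g w) :
    walkSum n f ≤ walkSum n g :=
  Finset.sum_le_sum fun _ _ => h _ (List.length_ofFn)

lemma walkSum_add (n : ℕ) (f g : List (Fin 4) → ℕ) :
    walkSum n (fun w => f w + g w) = walkSum n f + walkSum n g :=
  Finset.sum_add_distrib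

lemma walkSum_cons_le (n : ℕ) (g : List (Fin 4) → ℕ) (s : Fin 4) :
    walkSum n (fun w => g (s :: w)) ≤ walkSum (n + 1) g := by
  rw [walkSum_succ]
  exact Finset.single_le_sum (f := fun s => walkSum n (fun w => g (s :: w)))
    (fun _ _ => Nat.zero_le _) (Finset.mem_univ s)

/-- A walk `u` arises in at most `2 ^ loops u` ways by inserting backtracks. -/
lemma walkSum_insertions_le (n k : ℕ) (f : List (Fin 4) → ℕ) :
    walkSum n (fun w => ((insertions k w).map f).sum) ≤
      walkSum (n + 2 * k) (fun u => 2 ^ loops u * f u) := by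
  induction n generalizing k f with
  | zero =>
    cases k with
    | zero =>
      rw [mul_zero, add_zero, walkSum_zero, walkSum_zero]
      simpa [insertions] using Nat.le_mul_of_pos_left (f []) (by positivity)
    | succ k => simp [walkSum_zero, insertions]
  | succ n ih =>
    cases k with
    | zero =>
      refine walkSum_mono _ fun w _ => ?_
      simpa [insertions] using Nat.le_mul_of_pos_left _ (by positivity)
    | succ k =>
      rw [walkSum_succ, show n + 1 + 2 * (k + 1) = n + 2 * (k + 1) + 1 by ring, walkSum_succ]
      refine Finset.sum_le_sum fun s _ => ?_
      simp only [insertions, List.map_append, List.map_map, List.sum_append, walkSum_add]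
      have h1 := ih (k + 1) (fun w => f (s :: w))
      have h2 := ih k (fun w => f (s :: opp s :: s :: w))
      have h3 : walkSum (n + 2 * k) (fun u => 2 ^ loops u * f (s :: opp s :: s :: u)) ≤
          walkSum (n + 2 * (k + 1))
            (fun u => (2 ^ loops (s :: u) - 2 ^ loops u) * f (s :: u)) := by
        refine le_trans (walkSum_mono _ fun u _ => ?_) ((walkSum_cons_le (n + 2 * k)
          (fun v => (2 ^ loops (s :: opp s :: v) - 2 ^ loops (opp s :: v)) * f (s :: opp s :: v))
          s).trans (walkSum_cons_le (n + 2 * k + 1)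
          (fun u => (2 ^ loops (s :: u) - 2 ^ loops u) * f (s :: u)) (opp s)))
        refine Nat.mul_le_mul_right _ ?_
        have a1 : 2 ^ loops u ≤ 2 ^ loops (opp s :: s :: u) :=
          Nat.pow_le_pow_right two_pos ((loops_le_cons s u).trans (loops_le_cons _ _))
        have a2 : 2 ^ (loops (opp s :: s :: u) + 1) ≤ 2 ^ loops (s :: opp s :: s :: u) :=
          Nat.pow_le_pow_right two_pos (loops_backtrack s _)
        rw [pow_succ] at a2
        omega
      refine (add_le_add h1 (h2.trans h3)).trans ?_
      rw [← walkSum_add]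
      refine walkSum_mono _ fun u _ => ?_
      rw [← add_mul, Nat.add_sub_cancel' (Nat.pow_le_pow_right two_pos (loops_le_cons s u))]

/-- The number of walks of length `n` with at most `m` self-intersections. -/
def numWalks (n m : ℕ) : ℕ := walkSum n (fun w => if loops w ≤ m then 1 else 0)

lemma numWalks_add_le (n r m : ℕ) : numWalks (n + r) m ≤ 4 ^ r * numWalks n m := by
  induction r with
  | zero => simp
  | succ r ih =>
    have h : numWalks (n + r + 1) m ≤ 4 * numWalks (n + r) m := by
      rw [numWalks, walkSum_succ]
      refine (Finset.sum_le_card_nsmul _ _ (numWalks (n + r) m) fun s _ => ?_).trans (by simp)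
      refine walkSum_mono _ fun w _ => ?_
      have := loops_le_cons s w
      split_ifs <;> omega
    rw [← add_assoc, pow_succ]
    linarith

lemma choose_mul_numWalks_le (n k m : ℕ) (hm : 9 * m ≤ k) :
    n.choose k * numWalks (n + 2 * k) m ≤ 256 ^ k * numWalks (n + 2 * k) (4 * k) := by
  have h1 : n.choose k * numWalks n m ≤ 2 ^ (4 * k) * numWalks (n + 2 * k) (4 * k) := by
    calc n.choose k * numWalks n m
        ≤ walkSum n (fun w => ((insertions k w).map
            (fun u => if loops u ≤ 4 * k then 1 else 0)).sum) := by
          rw [numWalks, walkSum, Finset.mul_sum]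
          refine Finset.sum_le_sum fun ω _ => ?_
          split_ifs with h
          · have hs : ∀ u ∈ insertions k (List.ofFn ω),
                (if loops u ≤ 4 * k then 1 else 0) = 1 := by
              intro u hu
              have := loops_insertions_le _ _ _ hu
              rw [if_pos (by omega)]
            beta_reduce
            rw [List.map_congr_left hs]
            simp [length_insertions]
          · simp
      _ ≤ walkSum (n + 2 * k) (fun u => 2 ^ loops u * if loops u ≤ 4 * k then 1 else 0) :=
          walkSum_insertions_le _ _ _
      _ ≤ _ := by
          rw [numWalks, walkSum, walkSum, Finset.mul_sum]
          refine Finset.sum_le_sum fun ω _ => ?_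
          split_ifs with h
          · simpa using Nat.pow_le_pow_right two_pos h
          · simp
  calc n.choose k * numWalks (n + 2 * k) m
      ≤ n.choose k * (4 ^ (2 * k) * numWalks n m) :=
        Nat.mul_le_mul_left _ (numWalks_add_le n (2 * k) m)
    _ = 4 ^ (2 * k) * (n.choose k * numWalks n m) := by ring
    _ ≤ 4 ^ (2 * k) * (2 ^ (4 * k) * numWalks (n + 2 * k) (4 * k)) := Nat.mul_le_mul_left _ h1
    _ = _ := by
        rw [← mul_assoc, pow_mul, pow_mul, ← mul_pow]; norm_num

lemma numWalks_eq (n m : ℕ) :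
    (numWalks n m : ℝ) = ∑ ω : Fin n → Fin 4, if J n ω ≤ m then 1 else 0 := by
  simp only [numWalks, walkSum, loops, selfInt_visits_ofFn]
  push_cast
  rfl

lemma pow_le_choose_of_mul_le (a : ℝ) (ha : 0 ≤ a) (n k : ℕ) (h : (a + 1) * k ≤ n) :
    a ^ k ≤ n.choose k := by
  rcases Nat.eq_zero_or_pos k with rfl | hk
  · simp
  have hk' : (0 : ℝ) < k := by exact_mod_cast hk
  have hkn : k ≤ n := by
    have : (k : ℝ) ≤ n := by nlinarith
    exact_mod_cast this
  have h1 : ((n + 1 - k : ℕ) : ℝ) ^ k ≤ k.factorial * n.choose k := by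
    rw [← div_le_iff₀' (by positivity)]
    exact_mod_cast Nat.pow_le_choose (α := ℝ) k n
  have h2 : a * k ≤ ((n + 1 - k : ℕ) : ℝ) := by
    rw [Nat.cast_sub (by omega)]; push_cast; linarith
  have h3 : (k.factorial : ℝ) ≤ (k : ℝ) ^ k := by exact_mod_cast Nat.factorial_le_pow k
  have h4 : a ^ k * (k : ℝ) ^ k ≤ n.choose k * (k : ℝ) ^ k := by
    calc a ^ k * (k : ℝ) ^ k = (a * k) ^ k := (mul_pow _ _ _).symm
      _ ≤ ((n + 1 - k : ℕ) : ℝ) ^ k := by gcongr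
      _ ≤ k.factorial * n.choose k := h1
      _ ≤ (k : ℝ) ^ k * n.choose k := by gcongr
      _ = _ := mul_comm _ _
  exact le_of_mul_le_mul_right h4 (by positivity)

/-- The weight of the walks with at most `t ≤ k / 9` self-intersections is exponentially small
in `k` compared with that of the walks with fewer than `v` self-intersections, `4k < v`. -/
lemma E0_le_half_pow_mul (β : ℝ) (hβ : 0 < β) (n k : ℕ) (t v : ℝ) (ht : 9 * t ≤ k)
    (hv : 4 * (k : ℝ) < v) (hn : (3 + 512 * Real.exp (4 * β)) * k ≤ n) :
    E0 n (fun ω => Real.exp (-β * J n ω) * (if (J n ω : ℝ) ≤ t then 1 else 0)) ≤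
      (1 / 2) ^ k *
        E0 n (fun ω => Real.exp (-β * J n ω) * (if (J n ω : ℝ) < v then 1 else 0)) := by
  have he := Real.exp_pos (4 * β)
  have hkn : 2 * k ≤ n := by
    have : 2 * (k : ℝ) ≤ n := by nlinarith [(Nat.cast_nonneg k : (0 : ℝ) ≤ k)]
    exact_mod_cast this
  obtain ⟨N, rfl⟩ := Nat.exists_eq_add_of_le' hkn
  have hch : (512 * Real.exp (4 * β)) ^ k ≤ N.choose k := by
    apply pow_le_choose_of_mul_le _ (by positivity)
    push_cast at hn
    linarith
  have hcomb : (N.choose k : ℝ) * numWalks (N + 2 * k) (k / 9) ≤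
      256 ^ k * numWalks (N + 2 * k) (4 * k) := by
    exact_mod_cast choose_mul_numWalks_le N k (k / 9) (Nat.mul_div_le k 9)
  rw [E0, E0, ← mul_div_assoc]
  refine div_le_div_of_nonneg_right ?_ (by positivity)
  generalize N + 2 * k = n at *
  set B := ∑ ω : Fin n → Fin 4, Real.exp (-β * J n ω) * (if (J n ω : ℝ) < v then 1 else 0)
  have hA : ∑ ω : Fin n → Fin 4, Real.exp (-β * J n ω) * (if (J n ω : ℝ) ≤ t then 1 else 0) ≤
      numWalks n (k / 9) := by
    rw [numWalks_eq]
    refine Finset.sum_le_sum fun ω _ => ?_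
    split_ifs with h1 h2 h2
    · rw [mul_one, Real.exp_le_one_iff]
      have := mul_nonneg hβ.le (Nat.cast_nonneg (α := ℝ) (J n ω))
      linarith
    · refine absurd ?_ h2
      rw [Nat.le_div_iff_mul_le (by norm_num)]
      have : (J n ω : ℝ) * 9 ≤ k := by linarith
      exact_mod_cast this
    · simp
    · simp
  have hB : (numWalks n (4 * k) : ℝ) ≤ Real.exp (4 * β) ^ k * B := by
    rw [numWalks_eq, Finset.mul_sum]
    refine Finset.sum_le_sum fun ω _ => ?_
    split_ifs with h1 h2 h2
    · rw [mul_one, ← Real.exp_nat_mul, ← Real.exp_add, Real.one_le_exp_iff]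
      have : (J n ω : ℝ) ≤ 4 * k := by exact_mod_cast h1
      nlinarith
    · refine absurd (lt_of_le_of_lt ?_ hv) h2
      exact_mod_cast h1
    · positivity
    · simp
  have hfin : (512 * Real.exp (4 * β)) ^ k * (numWalks n (k / 9) : ℝ) ≤
      (512 * Real.exp (4 * β)) ^ k * ((1 / 2) ^ k * B) := by
    calc (512 * Real.exp (4 * β)) ^ k * (numWalks n (k / 9) : ℝ)
        ≤ N.choose k * numWalks n (k / 9) := by gcongr
      _ ≤ 256 ^ k * numWalks n (4 * k) := hcomb
      _ ≤ 256 ^ k * (Real.exp (4 * β) ^ k * B) := by gcongr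
      _ = _ := by
        rw [← mul_assoc, ← mul_assoc, ← mul_pow, ← mul_pow]
        congr 2
        ring
  exact hA.trans (le_of_mul_le_mul_left hfin (by positivity))

lemma E0_nonneg (n : ℕ) (f : (Fin n → Fin 4) → ℝ) (hf : ∀ ω, 0 ≤ f ω) : 0 ≤ E0 n f :=
  div_nonneg (Finset.sum_nonneg fun ω _ => hf ω) (by positivity)

lemma eventually_rpow_le (b δ : ℝ) (hb : 0 < b) (hδ : 0 < δ) :
    ∀ᶠ n : ℕ in atTop, 9 * (n : ℝ) ^ (1 - δ) ≤ ⌊b * n / 5⌋₊ := by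
  have h1 : Tendsto (fun n : ℕ => (n : ℝ) ^ (-δ)) atTop (nhds 0) :=
    (tendsto_rpow_neg_atTop hδ).comp tendsto_natCast_atTop_atTop
  have h2 : Tendsto (fun n : ℕ => b / 10 * (n : ℝ)) atTop atTop :=
    tendsto_natCast_atTop_atTop.const_mul_atTop (by positivity)
  filter_upwards [h1.eventually_le_const (show (0 : ℝ) < b / 90 by positivity),
    h2.eventually_ge_atTop 1, eventually_gt_atTop 0] with n hn1 hn2 hn3
  have hn : (0 : ℝ) < n := by exact_mod_cast hn3
  have h3 : (n : ℝ) ^ (1 - δ) = n * (n : ℝ) ^ (-δ) := by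
    rw [sub_eq_add_neg, Real.rpow_add hn, Real.rpow_one]
  have h4 := Nat.lt_floor_add_one (b * n / 5)
  have h5 := mul_le_mul_of_nonneg_left hn1 hn.le
  rw [h3]
  linarith

/-- Let `β > 0`. There is `b* = b*(β) > 0` such that for every `δ > 0` and
every `0 < b < b*`,
`E_0[e^{−βJ_n} 1{J_n ≤ n^{1−δ}}] = o(E_0[e^{−βJ_n} 1{J_n < bn}])` as `n → ∞`. -/
theorem statement5 (β : ℝ) (hβ : 0 < β) :
    ∃ bstar : ℝ, 0 < bstar ∧ ∀ δ : ℝ, 0 < δ → ∀ b : ℝ, 0 < b → b < bstar →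
      (fun n : ℕ =>
          E0 n (fun ω =>
            Real.exp (-β * J n ω) *
              (if (J n ω : ℝ) ≤ (n : ℝ) ^ (1 - δ) then 1 else 0)))
        =o[Filter.atTop]
      (fun n : ℕ =>
          E0 n (fun ω =>
            Real.exp (-β * J n ω) * (if (J n ω : ℝ) < b * n then 1 else 0))) := by
  refine ⟨5 / (3 + 512 * Real.exp (4 * β)), by positivity, fun δ hδ b hb hb' => ?_⟩
  have hk : Tendsto (fun n : ℕ => ⌊b * n / 5⌋₊) atTop atTop :=
    tendsto_nat_floor_atTop.comp
      ((tendsto_natCast_atTop_atTop.const_mul_atTop hb).atTop_div_const (by norm_num))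
  have hpow : Tendsto (fun n : ℕ => (1 / 2 : ℝ) ^ ⌊b * n / 5⌋₊) atTop (nhds 0) :=
    (tendsto_pow_atTop_nhds_zero_of_lt_one (by norm_num) (by norm_num)).comp hk
  refine Asymptotics.isLittleO_iff.2 fun ε hε => ?_
  filter_upwards [hpow.eventually_le_const hε, eventually_rpow_le b δ hb hδ,
    eventually_gt_atTop 0] with n hn1 hn2 hn3
  have hn : (0 : ℝ) < n := by exact_mod_cast hn3
  have hbn : 0 < b * n := by positivity
  have hfl : (⌊b * n / 5⌋₊ : ℝ) ≤ b * n / 5 := Nat.floor_le (by positivity)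
  have hC : b * (3 + 512 * Real.exp (4 * β)) ≤ 5 := by
    rw [lt_div_iff₀ (by positivity)] at hb'
    exact hb'.le
  have hmain := E0_le_half_pow_mul β hβ n ⌊b * n / 5⌋₊ ((n : ℝ) ^ (1 - δ)) (b * n) hn2
    (by linarith) (by
      calc (3 + 512 * Real.exp (4 * β)) * (⌊b * n / 5⌋₊ : ℝ)
          ≤ (3 + 512 * Real.exp (4 * β)) * (b * n / 5) := by gcongr
        _ = b * (3 + 512 * Real.exp (4 * β)) * n / 5 := by ring
        _ ≤ 5 * n / 5 := by gcongr
        _ = n := by ring)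
  have hB := E0_nonneg n
    (fun ω => Real.exp (-β * J n ω) * (if (J n ω : ℝ) < b * n then 1 else 0))
    (fun ω => by positivity)
  rw [Real.norm_of_nonneg (E0_nonneg n _ fun ω => by positivity), Real.norm_of_nonneg hB]
  exact hmain.trans (mul_le_mul_of_nonneg_right hn1 hB)
end
end

section
/- Let β > 0. There exists b* = b*(β) > 0 such that for every sequence of positive reals (q_n) with q_n → 0 as n → ∞ and every 0 < b < b*, E_0[e^{−βJ_n} · 1{J_n ≤ n q_n}] = o(E_0[e^{−βJ_n} · 1{J_n < bn}]) as n → ∞. -/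
open Filter Real Finset

noncomputable section

/-- The index of the step opposite to a given one. -/
def oppStep : Fin 4 → Fin 4 := ![1, 0, 3, 2]

lemma dir_oppStep (a : Fin 4) : dir (oppStep a) = -dir a := by
  fin_cases a <;> rfl

lemma pos_succ {n : ℕ} (ω : Fin n → Fin 4) {k : ℕ} (hk : k < n) :
    pos n ω (k + 1) = pos n ω k + dir (ω ⟨k, hk⟩) := by
  have h : ∀ i : Fin n, (if (i : ℕ) < k + 1 then dir (ω i) else 0) =
      (if (i : ℕ) < k then dir (ω i) else 0) +
        (if i = ⟨k, hk⟩ then dir (ω i) else 0) := by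
    intro i
    by_cases h1 : (i : ℕ) < k
    · have h2 : i ≠ ⟨k, hk⟩ := by
        rintro rfl
        exact lt_irrefl _ h1
      simp [h1, h2, Nat.lt_succ_of_lt h1]
    · by_cases h2 : i = ⟨k, hk⟩
      · subst h2
        simp
      · have h3 : ¬ (i : ℕ) < k + 1 := by
          intro h3
          exact h2 (Fin.ext (by simp only; omega))
        simp [h1, h2, h3]
  unfold pos
  rw [Finset.sum_congr rfl (fun i _ => h i), Finset.sum_add_distrib]
  simp

/-- Traverse the step at time `t` forwards, backwards and forwards again, then continue along the
original path, dropping its last two steps. -/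
def insertBacktrack {n : ℕ} (ω : Fin n → Fin 4) (t : ℕ) (i : Fin n) : Fin 4 :=
  if (i : ℕ) ≤ t then ω i
  else if (i : ℕ) = t + 1 then oppStep (ω ⟨i - 1, by omega⟩)
  else ω ⟨i - 2, by omega⟩

lemma pos_insertBacktrack {n : ℕ} (ω : Fin n → Fin 4) (t : ℕ) {k : ℕ} (hk : k ≤ n) :
    pos n (insertBacktrack ω t) k = pos n ω (if k ≤ t + 1 then k else k - 2) := by
  induction k with
  | zero => simp [pos]
  | succ k ih =>
    rw [pos_succ _ hk, ih (by omega)]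
    rcases lt_trichotomy k (t + 1) with h | rfl | h
    · rw [if_pos (by omega), if_pos (by omega), pos_succ ω hk, insertBacktrack,
        if_pos (by simp only; omega)]
    · rw [if_pos le_rfl, if_neg (by omega), pos_succ ω (by omega : t < n), insertBacktrack,
        if_neg (by simp), if_pos rfl, dir_oppStep]
      simp
    · obtain ⟨l, rfl⟩ : ∃ l, k = l + 2 := ⟨k - 2, by omega⟩
      rw [if_neg (by omega), if_neg (by omega), insertBacktrack,
        if_neg (by simp only; omega), if_neg (by simp only; omega)]
      exact (pos_succ ω (by omega : l < n)).symm

/-- The pairs of times at which the walk occupies the same site. -/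
def intersectionPairs (n : ℕ) (ω : Fin n → Fin 4) : Finset (ℕ × ℕ) :=
  (Finset.range (n + 1) ×ˢ Finset.range (n + 1)).filter
    (fun p => p.1 < p.2 ∧ pos n ω p.1 = pos n ω p.2)

lemma mem_intersectionPairs {n : ℕ} {ω : Fin n → Fin 4} {i j : ℕ} :
    (i, j) ∈ intersectionPairs n ω ↔ i < j ∧ j ≤ n ∧ pos n ω i = pos n ω j := by
  simp only [intersectionPairs, Finset.mem_filter, Finset.mem_product, Finset.mem_range]
  constructor
  · rintro ⟨⟨_, h⟩, h1, h2⟩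
    exact ⟨h1, by omega, h2⟩
  · rintro ⟨h1, h, h2⟩
    exact ⟨⟨by omega, by omega⟩, h1, h2⟩

lemma card_intersectionPairs (n : ℕ) (ω : Fin n → Fin 4) :
    (intersectionPairs n ω).card = J n ω := rfl

/-- The site occupied at time `t` is visited at no other time. -/
def VisitedOnce {n : ℕ} (ω : Fin n → Fin 4) (t : ℕ) : Prop :=
  ∀ s ≤ n, pos n ω s = pos n ω t → s = t

lemma J_insertBacktrack_le {n : ℕ} {ω : Fin n → Fin 4} {t : ℕ}
    (h0 : VisitedOnce ω t) (h1 : VisitedOnce ω (t + 1)) :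
    J n (insertBacktrack ω t) ≤ J n ω + 2 := by
  have hsub : intersectionPairs n (insertBacktrack ω t) ⊆
      (intersectionPairs n ω).image (fun p =>
        ((if p.1 ≤ t + 1 then p.1 else p.1 + 2), (if p.2 ≤ t + 1 then p.2 else p.2 + 2))) ∪
      {(t, t + 2), (t + 1, t + 3)} := by
    rintro ⟨i, j⟩ hij
    obtain ⟨hlt, hj, he⟩ := mem_intersectionPairs.1 hij
    rw [pos_insertBacktrack ω t (by omega), pos_insertBacktrack ω t hj] at he
    set u := if i ≤ t + 1 then i else i - 2 with hu
    set v := if j ≤ t + 1 then j else j - 2 with hv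
    have hun : u ≤ n := by split_ifs at hu <;> omega
    have hvn : v ≤ n := by split_ifs at hv <;> omega
    simp only [Finset.mem_union, Finset.mem_insert, Finset.mem_singleton, Prod.mk.injEq,
      Finset.mem_image, Prod.exists]
    by_cases huv : u = v
    · right
      split_ifs at hu hv <;> omega
    · left
      have a1 : u ≠ t := fun h => huv (by rw [h]; exact (h0 v hvn (by rw [← he, h])).symm)
      have a2 : u ≠ t + 1 := fun h => huv (by rw [h]; exact (h1 v hvn (by rw [← he, h])).symm)
      have a3 : v ≠ t := fun h => huv (by rw [h]; exact h0 u hun (by rw [he, h]))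
      have a4 : v ≠ t + 1 := fun h => huv (by rw [h]; exact h1 u hun (by rw [he, h]))
      refine ⟨u, v, mem_intersectionPairs.2 ⟨?_, hvn, he⟩, ?_, ?_⟩ <;>
        split_ifs at hu hv ⊢ <;> omega
  calc J n (insertBacktrack ω t) = _ := (card_intersectionPairs _ _).symm
    _ ≤ _ := Finset.card_le_card hsub
    _ ≤ _ := Finset.card_union_le _ _
    _ ≤ J n ω + 2 := Nat.add_le_add Finset.card_image_le Finset.card_le_two

lemma card_backtracks_le (n : ℕ) (ω : Fin n → Fin 4) :
    ((Finset.range (n - 1)).filter (fun t => pos n ω t = pos n ω (t + 2))).card ≤ J n ω := by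
  rw [← card_intersectionPairs]
  refine Finset.card_le_card_of_injOn (fun t => (t, t + 2)) ?_ ?_
  · intro t ht
    simp only [Finset.coe_filter, Finset.mem_range, Set.mem_ofPred_eq] at ht
    exact mem_intersectionPairs.2 ⟨by omega, by omega, ht.2⟩
  · intro a _ b _ h
    exact (Prod.mk.inj h).1

open Classical in
/-- The times at which a backtrack can be inserted at the cost of two self-intersections. -/
def goodTimes {n : ℕ} (ω : Fin n → Fin 4) : Finset ℕ :=
  (Finset.range (n - 1)).filter (fun t => VisitedOnce ω t ∧ VisitedOnce ω (t + 1))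

lemma le_card_goodTimes {n : ℕ} (ω : Fin n → Fin 4) :
    n ≤ (goodTimes ω).card + 4 * J n ω + 1 := by
  classical
  set D : Finset ℕ := (intersectionPairs n ω).image Prod.fst ∪
    (intersectionPairs n ω).image Prod.snd with hD
  have hDc : D.card ≤ 2 * J n ω := by
    refine (Finset.card_union_le _ _).trans ?_
    rw [two_mul, ← card_intersectionPairs]
    exact Nat.add_le_add Finset.card_image_le Finset.card_image_le
  have hmem : ∀ t ≤ n, ¬ VisitedOnce ω t → t ∈ D := by
    intro t ht h
    simp only [VisitedOnce, not_forall] at h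
    obtain ⟨s, hs, he, hne⟩ := h
    rw [hD, Finset.mem_union, Finset.mem_image, Finset.mem_image]
    rcases lt_or_gt_of_ne hne with h | h
    · exact Or.inr ⟨(s, t), mem_intersectionPairs.2 ⟨h, ht, he⟩, rfl⟩
    · exact Or.inl ⟨(t, s), mem_intersectionPairs.2 ⟨h, hs, he.symm⟩, rfl⟩
  have hsub : Finset.range (n - 1) ⊆ goodTimes ω ∪ (D ∪ D.image (fun t => t - 1)) := by
    intro t ht
    have ht' := Finset.mem_range.1 ht
    by_cases h0 : VisitedOnce ω t
    · by_cases h1 : VisitedOnce ω (t + 1)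
      · exact Finset.mem_union_left _ (Finset.mem_filter.2 ⟨ht, h0, h1⟩)
      · exact Finset.mem_union_right _ (Finset.mem_union_right _
          (Finset.mem_image.2 ⟨t + 1, hmem _ (by omega) h1, by simp⟩))
    · exact Finset.mem_union_right _ (Finset.mem_union_left _ (hmem _ (by omega) h0))
  have h := Finset.card_le_card hsub
  rw [Finset.card_range] at h
  have h1 := Finset.card_union_le (goodTimes ω) (D ∪ D.image (fun t => t - 1))
  have h2 := Finset.card_union_le D (D.image (fun t => t - 1))
  have h3 : (D.image (fun t => t - 1)).card ≤ D.card := Finset.card_image_le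
  omega

/-- A path is determined by the time of an inserted backtrack, the resulting path, and the two
dropped steps. -/
lemma eq_of_insertBacktrack_eq {n : ℕ} (hn : 2 ≤ n) {ω η : Fin n → Fin 4} {t : ℕ}
    (h : insertBacktrack ω t = insertBacktrack η t)
    (h1 : ω ⟨n - 2, by omega⟩ = η ⟨n - 2, by omega⟩)
    (h2 : ω ⟨n - 1, by omega⟩ = η ⟨n - 1, by omega⟩) : ω = η := by
  funext i
  obtain ⟨i, hi⟩ := i
  by_cases a : i ≤ t
  · simpa [insertBacktrack, a] using congrFun h ⟨i, hi⟩
  · by_cases b : i + 2 < n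
    · have a' : ¬ i + 2 ≤ t := by omega
      have a'' : ¬ i + 2 = t + 1 := by omega
      simpa [insertBacktrack, a', a''] using congrFun h ⟨i + 2, b⟩
    · obtain rfl | rfl : i = n - 2 ∨ i = n - 1 := by omega
      · exact h1
      · exact h2

/-- The total weight of the paths with at most `m` self-intersections. -/
def truncWeight (β : ℝ) (n m : ℕ) : ℝ :=
  ∑ ω : Fin n → Fin 4 with J n ω ≤ m, Real.exp (-β * J n ω)

lemma truncWeight_nonneg (β : ℝ) (n m : ℕ) : 0 ≤ truncWeight β n m :=
  Finset.sum_nonneg fun _ _ => (Real.exp_pos _).le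

lemma mul_truncWeight_le {β : ℝ} (hβ : 0 < β) {n : ℕ} (hn : 2 ≤ n) (m : ℕ) :
    ((n : ℝ) - 1 - 4 * m) * truncWeight β n m ≤
      16 * Real.exp (2 * β) * (m + 2) * truncWeight β n (m + 2) := by
  classical
  set w : (Fin n → Fin 4) → ℝ := fun ω => Real.exp (-β * J n ω) with hw
  have hw0 : ∀ ω, 0 ≤ w ω := fun ω => (Real.exp_pos _).le
  set A : Finset (Fin n → Fin 4) := Finset.univ.filter (fun ω => J n ω ≤ m) with hA
  set B : Finset (Fin n → Fin 4) := Finset.univ.filter (fun ω => J n ω ≤ m + 2) with hB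
  set T : (Fin n → Fin 4) → Finset ℕ := fun ω =>
    (Finset.range (n - 1)).filter (fun t => pos n ω t = pos n ω (t + 2)) with hT
  set F : (Σ _ : Fin n → Fin 4, ℕ) → (Σ _ : Fin n → Fin 4, ℕ) × (Fin 4 × Fin 4) := fun p =>
    (⟨insertBacktrack p.1 p.2, p.2⟩, (p.1 ⟨n - 2, by omega⟩, p.1 ⟨n - 1, by omega⟩)) with hF
  have hFinj : Function.Injective F := by
    rintro ⟨ω, t⟩ ⟨η, s⟩ h
    simp only [hF, Prod.mk.injEq, Sigma.mk.injEq, heq_eq_eq] at h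
    obtain ⟨⟨h, rfl⟩, h1, h2⟩ := h
    rw [eq_of_insertBacktrack_eq hn h h1 h2]
  have hFmem : (A.sigma fun ω => goodTimes ω).image F ⊆ (B.sigma T) ×ˢ Finset.univ := by
    intro x hx
    obtain ⟨⟨ω, t⟩, hp, rfl⟩ := Finset.mem_image.1 hx
    obtain ⟨hω, ht⟩ := Finset.mem_sigma.1 hp
    obtain ⟨ht, h0, h1⟩ := Finset.mem_filter.1 ht
    have hJ : J n (insertBacktrack ω t) ≤ J n ω + 2 := J_insertBacktrack_le h0 h1
    have hω' : J n ω ≤ m := (Finset.mem_filter.1 hω).2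
    have ht' : t < n - 1 := Finset.mem_range.1 ht
    refine Finset.mem_product.2 ⟨Finset.mem_sigma.2 ⟨?_, ?_⟩, Finset.mem_univ _⟩
    · exact Finset.mem_filter.2 ⟨Finset.mem_univ _, hJ.trans (by omega)⟩
    · refine Finset.mem_filter.2 ⟨ht, ?_⟩
      simp only [hF]
      rw [pos_insertBacktrack ω t (by omega), pos_insertBacktrack ω t (by omega)]
      simp
  have hcard : ∀ ω ∈ A, (n : ℝ) - 1 - 4 * m ≤ (goodTimes ω).card := by
    intro ω hω
    have h1 : (n : ℝ) ≤ (goodTimes ω).card + 4 * J n ω + 1 := by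
      exact_mod_cast le_card_goodTimes ω
    have h2 : (J n ω : ℝ) ≤ m := by exact_mod_cast (Finset.mem_filter.1 hω).2
    linarith
  have hstep : ∀ p ∈ A.sigma fun ω => goodTimes ω,
      w p.1 ≤ Real.exp (2 * β) * w (F p).1.1 := by
    rintro ⟨ω, t⟩ hp
    obtain ⟨-, ht⟩ := Finset.mem_sigma.1 hp
    obtain ⟨-, h0, h1⟩ := Finset.mem_filter.1 ht
    have hJ : (J n (insertBacktrack ω t) : ℝ) ≤ J n ω + 2 := by
      exact_mod_cast J_insertBacktrack_le h0 h1
    simp only [hw, hF]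
    rw [← Real.exp_add]
    apply Real.exp_le_exp.2
    nlinarith
  calc ((n : ℝ) - 1 - 4 * m) * truncWeight β n m
      = ∑ ω ∈ A, ((n : ℝ) - 1 - 4 * m) * w ω := by rw [truncWeight, Finset.mul_sum]
    _ ≤ ∑ ω ∈ A, ((goodTimes ω).card : ℝ) * w ω :=
        Finset.sum_le_sum fun ω hω => mul_le_mul_of_nonneg_right (hcard ω hω) (hw0 ω)
    _ = ∑ p ∈ A.sigma fun ω => goodTimes ω, w p.1 := by
        rw [Finset.sum_sigma]
        simp
    _ ≤ ∑ p ∈ A.sigma fun ω => goodTimes ω, Real.exp (2 * β) * w (F p).1.1 :=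
        Finset.sum_le_sum hstep
    _ = Real.exp (2 * β) * ∑ x ∈ (A.sigma fun ω => goodTimes ω).image F, w x.1.1 := by
        rw [Finset.sum_image hFinj.injOn, Finset.mul_sum]
    _ ≤ Real.exp (2 * β) * ∑ x ∈ (B.sigma T) ×ˢ (Finset.univ : Finset (Fin 4 × Fin 4)),
          w x.1.1 :=
        mul_le_mul_of_nonneg_left
          (Finset.sum_le_sum_of_subset_of_nonneg hFmem fun x _ _ => hw0 _) (Real.exp_pos _).le
    _ = 16 * Real.exp (2 * β) * ∑ ω ∈ B, ((T ω).card : ℝ) * w ω := by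
        simp only [Finset.sum_product_right, Finset.sum_const, Finset.sum_sigma]
        simp
        ring
    _ ≤ 16 * Real.exp (2 * β) * ∑ ω ∈ B, ((m : ℝ) + 2) * w ω := by
        refine mul_le_mul_of_nonneg_left (Finset.sum_le_sum fun ω hω => ?_) (by positivity)
        refine mul_le_mul_of_nonneg_right ?_ (hw0 ω)
        exact_mod_cast (card_backtracks_le n ω).trans (Finset.mem_filter.1 hω).2
    _ = 16 * Real.exp (2 * β) * (m + 2) * truncWeight β n (m + 2) := by
        rw [truncWeight, ← Finset.mul_sum, mul_assoc]
        simp only [hw, hB]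
        ring

lemma two_mul_truncWeight_le {β : ℝ} (hβ : 0 < β) {n m : ℕ}
    (h : 64 * Real.exp (2 * β) * (m + 2) ≤ n) :
    2 * truncWeight β n m ≤ truncWeight β n (m + 2) := by
  have he : 1 ≤ Real.exp (2 * β) := Real.one_le_exp (by positivity)
  have hm : (0 : ℝ) ≤ m := Nat.cast_nonneg m
  have h64 : 64 * ((m : ℝ) + 2) ≤ n := by nlinarith
  have hn : 2 ≤ n := by
    have : (2 : ℝ) ≤ n := by linarith
    exact_mod_cast this
  have key := mul_truncWeight_le hβ hn m
  have h0 := truncWeight_nonneg β n m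
  have h1 := truncWeight_nonneg β n (m + 2)
  have hn0 : (0 : ℝ) < n := by linarith
  have a1 : (n : ℝ) / 2 * truncWeight β n m ≤ ((n : ℝ) - 1 - 4 * m) * truncWeight β n m :=
    mul_le_mul_of_nonneg_right (by linarith) h0
  have a2 : 16 * Real.exp (2 * β) * (m + 2) * truncWeight β n (m + 2) ≤
      (n : ℝ) / 4 * truncWeight β n (m + 2) :=
    mul_le_mul_of_nonneg_right (by linarith) h1
  have a3 : (n : ℝ) / 4 * (2 * truncWeight β n m) ≤ (n : ℝ) / 4 * truncWeight β n (m + 2) := by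
    linarith
  exact le_of_mul_le_mul_left a3 (by positivity)

lemma two_pow_mul_truncWeight_le {β : ℝ} (hβ : 0 < β) {n m : ℕ} (k : ℕ)
    (h : 64 * Real.exp (2 * β) * (m + 2 * k) ≤ n) :
    2 ^ k * truncWeight β n m ≤ truncWeight β n (m + 2 * k) := by
  induction k with
  | zero => simp
  | succ k ih =>
    push_cast at h
    have he := Real.exp_pos (2 * β)
    have h1 := ih (by nlinarith)
    have h2 := two_mul_truncWeight_le hβ (n := n) (m := m + 2 * k) (by push_cast; linarith)
    rw [show m + 2 * (k + 1) = m + 2 * k + 2 by ring, pow_succ]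
    linarith

/-- Let `β > 0`. There is `b* = b*(β) > 0` such that for every sequence of
positive reals `q_n → 0` and every `0 < b < b*`,
`E_0[e^{−βJ_n} 1{J_n ≤ n q_n}] = o(E_0[e^{−βJ_n} 1{J_n < bn}])` as `n → ∞`. -/
theorem statement6 (β : ℝ) (hβ : 0 < β) :
    ∃ bstar : ℝ, 0 < bstar ∧
      ∀ q : ℕ → ℝ, (∀ n, 0 < q n) → Filter.Tendsto q Filter.atTop (nhds 0) →
      ∀ b : ℝ, 0 < b → b < bstar →
      (fun n : ℕ =>
          E0 n (fun ω =>
            Real.exp (-β * J n ω) *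
              (if (J n ω : ℝ) ≤ (n : ℝ) * q n then 1 else 0)))
        =o[Filter.atTop]
      (fun n : ℕ =>
          E0 n (fun ω =>
            Real.exp (-β * J n ω) * (if (J n ω : ℝ) < b * n then 1 else 0))) := by
  have he := Real.exp_pos (2 * β)
  refine ⟨1 / (64 * Real.exp (2 * β)), by positivity, ?_⟩
  intro q hq hq0 b hb hbs
  have hbs' : 64 * Real.exp (2 * β) * b ≤ 1 := by
    rw [lt_div_iff₀ (by positivity)] at hbs
    linarith
  rw [Asymptotics.isLittleO_iff]
  intro c hc
  obtain ⟨k, hk⟩ := pow_unbounded_of_one_lt (1 / c) (one_lt_two : (1 : ℝ) < 2)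
  have hlim := tendsto_natCast_atTop_atTop (R := ℝ)
  filter_upwards [hq0.eventually_lt_const (half_pos hb),
    hlim.eventually_gt_atTop (2 * k / (b / 2))] with n hqn hnk
  have hn0 : (0 : ℝ) ≤ n := Nat.cast_nonneg n
  rw [div_lt_iff₀ (by positivity)] at hnk
  set m := ⌊(n : ℝ) * q n⌋₊ with hm
  have hnq : 0 ≤ (n : ℝ) * q n := mul_nonneg hn0 (hq n).le
  have hmle : (m : ℝ) ≤ n * q n := Nat.floor_le hnq
  have hmb : (m : ℝ) + 2 * k < b * n := by nlinarith
  have hgrow := two_pow_mul_truncWeight_le hβ (n := n) (m := m) k (by nlinarith)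
  have hnum : E0 n (fun ω => Real.exp (-β * J n ω) *
      (if (J n ω : ℝ) ≤ (n : ℝ) * q n then 1 else 0)) = truncWeight β n m / 4 ^ n := by
    simp only [E0, truncWeight, Finset.sum_filter, mul_ite, mul_one, mul_zero, hm,
      Nat.le_floor_iff hnq]
  have hden : truncWeight β n (m + 2 * k) / 4 ^ n ≤ E0 n (fun ω => Real.exp (-β * J n ω) *
      (if (J n ω : ℝ) < b * n then 1 else 0)) := by
    simp only [E0, truncWeight, mul_ite, mul_one, mul_zero, ← Finset.sum_filter]
    gcongr ?_ / _
    refine Finset.sum_le_sum_of_subset_of_nonneg ?_ fun _ _ _ => (Real.exp_pos _).le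
    intro ω hω
    rw [Finset.mem_filter] at hω ⊢
    have hJ : (J n ω : ℝ) ≤ m + 2 * k := by exact_mod_cast hω.2
    exact ⟨hω.1, hJ.trans_lt hmb⟩
  have h0 := truncWeight_nonneg β n m
  have hle : truncWeight β n m ≤ c * truncWeight β n (m + 2 * k) := by
    rw [div_lt_iff₀ hc] at hk
    nlinarith
  rw [hnum, Real.norm_of_nonneg (by positivity)]
  calc truncWeight β n m / 4 ^ n ≤ c * truncWeight β n (m + 2 * k) / 4 ^ n := by gcongr
    _ = c * (truncWeight β n (m + 2 * k) / 4 ^ n) := mul_div_assoc _ _ _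
    _ ≤ c * ‖_‖ := mul_le_mul_of_nonneg_left (hden.trans (le_abs_self _)) hc.le
end
end
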